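/- arXiv:1107.1386 — 2 statements merged into one kernel-verified Lean document; each statement's English description precedes it below -/
import Mathlib

section
/- Let X be a nonempty separable metrizable space with a bounded compatible metric d, and let (M(X), D) be the metric space of equivalence classes (modulo Lebesgue-a.e. equality) of Lebesgue measurable functions [0,1] → X with D(f,g) = ∫₀¹ d(f(t), g(t)) dt. Let A ⊆ X with A ≠ X, and let M(A) = { [u] ∈ M(X) : u(t) ∈ A for almost every t }. Then M(A) is of type Z in (M(X), D): for every ε > 0 and every continuous map F from the Hilbert cube Q = ℕ → [0,1] (with the product topology) to (M(X), D) there exists a continuous map G : Q → M(X) with G(Q) ∩ M(A) = ∅ and D(F(q), G(q)) < ε for all q ∈ Q. -/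
open MeasureTheory Topology Set TopologicalSpace

/-- The unit interval `[0,1]` with the (completed) Lebesgue measure. -/
abbrev I01 : Type := Set.Icc (0 : ℝ) 1

/-- The Hilbert cube `Q = ℕ → [0,1]`, with the product topology. -/
abbrev HCube : Type := ℕ → unitInterval

/-- `M(X)`: equivalence classes, modulo equality Lebesgue-a.e., of Lebesgue measurable
functions from `[0,1]` to `X`. -/
abbrev MSpace (X : Type*) [TopologicalSpace X] :=
  MeasureTheory.AEEqFun I01 X (volume : Measure I01)

/-- The metric `D(f,g) = ∫₀¹ d(f(t),g(t)) dt` on `M(X)`. -/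
noncomputable def mDist {X : Type*} [MetricSpace X] (f g : MSpace X) : ℝ :=
  ∫ t : I01, dist (f t) (g t) ∂(volume : Measure I01)

/-- The topology induced by a distance function `ρ` on `S`: the topology generated
by the `ρ`-balls. -/
def metricTop {S : Type*} (ρ : S → S → ℝ) : TopologicalSpace S :=
  TopologicalSpace.generateFrom
    {U : Set S | ∃ (c : S) (ε : ℝ), 0 < ε ∧ U = {y : S | ρ c y < ε}}

/-- `M(A) ⊆ M(X)`: classes of functions taking values in `A` almost everywhere. -/
def mSet {X : Type*} [TopologicalSpace X] (A : Set X) : Set (MSpace X) :=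
  {f : MSpace X | ∀ᵐ t ∂(volume : Measure I01), f t ∈ A}

section Patch

variable {X : Type*} [MetricSpace X]

lemma integrable_dist_coeFn {C : ℝ} (hC : ∀ x y : X, dist x y ≤ C) (f g : MSpace X) :
    Integrable (fun t : I01 => dist (f t) (g t)) volume :=
  Integrable.of_bound (f.aestronglyMeasurable.dist g.aestronglyMeasurable) C
    (Filter.Eventually.of_forall fun t => by
      rw [Real.norm_of_nonneg dist_nonneg]; exact hC _ _)

lemma mDist_self (f : MSpace X) : mDist f f = 0 := by simp [mDist]

lemma mDist_triangle {C : ℝ} (hC : ∀ x y : X, dist x y ≤ C) (f g h : MSpace X) :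
    mDist f h ≤ mDist f g + mDist g h := by
  unfold mDist
  rw [← integral_add (integrable_dist_coeFn hC f g) (integrable_dist_coeFn hC g h)]
  exact integral_mono (integrable_dist_coeFn hC f h)
    ((integrable_dist_coeFn hC f g).add (integrable_dist_coeFn hC g h))
    fun t => dist_triangle _ _ _

/-- A `D`-nonexpansive self-map of `M(X)` is continuous for the topology induced by `D`. -/
lemma continuous_metricTop_of_nonexpansive {C : ℝ} (hC : ∀ x y : X, dist x y ≤ C)
    {P : MSpace X → MSpace X} (hP : ∀ f g, mDist (P f) (P g) ≤ mDist f g) :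
    @Continuous _ _ (metricTop (mDist (X := X))) (metricTop (mDist (X := X))) P := by
  let _ : TopologicalSpace (MSpace X) := metricTop (mDist (X := X))
  refine continuous_generateFrom_iff.2 ?_
  rintro _ ⟨c, r, hr, rfl⟩
  refine isOpen_iff_forall_mem_open.2 fun f hf => ?_
  have hf' : mDist c (P f) < r := hf
  refine ⟨{g | mDist f g < r - mDist c (P f)}, fun g hg => ?_,
    isOpen_generateFrom_of_mem ⟨f, _, sub_pos.2 hf', rfl⟩, ?_⟩
  · have hg' : mDist f g < r - mDist c (P f) := hg
    have h₁ := mDist_triangle hC c (P f) (P g)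
    have h₂ := hP f g
    show mDist c (P g) < r
    linarith
  · show mDist f f < r - mDist c (P f)
    rw [mDist_self]
    exact sub_pos.2 hf'

open scoped Classical in
/-- The class of `f` redefined to take the value `x` on the measurable set `S`. -/
noncomputable def patch {S : Set I01} (hS : MeasurableSet S) (x : X) (f : MSpace X) : MSpace X :=
  AEEqFun.mk (S.piecewise (fun _ => x) f)
    (StronglyMeasurable.piecewise hS stronglyMeasurable_const
      f.stronglyMeasurable).aestronglyMeasurable

open scoped Classical in
lemma coeFn_patch {S : Set I01} (hS : MeasurableSet S) (x : X) (f : MSpace X) :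
    patch hS x f =ᵐ[volume] S.piecewise (fun _ => x) f :=
  AEEqFun.coeFn_mk _ _

lemma mDist_patch_patch_le {C : ℝ} (hC : ∀ x y : X, dist x y ≤ C) {S : Set I01}
    (hS : MeasurableSet S) (x : X) (f g : MSpace X) :
    mDist (patch hS x f) (patch hS x g) ≤ mDist f g := by
  refine integral_mono_ae (integrable_dist_coeFn hC _ _) (integrable_dist_coeFn hC f g) ?_
  filter_upwards [coeFn_patch hS x f, coeFn_patch hS x g] with t hf hg
  rw [hf, hg]
  by_cases ht : t ∈ S <;> simp [ht]

lemma mDist_patch_le {C : ℝ} (hC : ∀ x y : X, dist x y ≤ C) {S : Set I01}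
    (hS : MeasurableSet S) (x : X) (f : MSpace X) :
    mDist f (patch hS x f) ≤ volume.real S * C := by
  have hint : ∫ t : I01, S.indicator (fun _ => C) t = volume.real S * C := by
    rw [integral_indicator_const _ hS, smul_eq_mul]
  rw [← hint]
  refine integral_mono_ae (integrable_dist_coeFn hC _ _)
    ((integrable_const C).indicator hS) ?_
  filter_upwards [coeFn_patch hS x f] with t hf
  rw [hf]
  by_cases ht : t ∈ S <;> simp [ht, hC]

lemma patch_notMem_mSet {S : Set I01} (hS : MeasurableSet S) (hpos : volume S ≠ 0) {A : Set X}
    {x : X} (hx : x ∉ A) (f : MSpace X) : patch hS x f ∉ mSet A := by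
  intro (h : ∀ᵐ t, patch hS x f t ∈ A)
  refine hpos (measure_mono_null (fun t ht => ?_) (ae_iff.1 (h.and (coeFn_patch hS x f))))
  rintro ⟨h₁, h₂⟩
  exact hx (by simpa [h₂, ht] using h₁)

end Patch

/-- **`M(A)` is of type `Z` in `(M(X), D)` whenever `A ≠ X`.**
For a nonempty separable metric space `X` with bounded metric and a proper subset `A` of
`X`, every continuous map of the Hilbert cube into `(M(X), D)` can be uniformly
approximated by continuous maps avoiding `M(A)`. -/
theorem mSet_isZType
    (X : Type*) [MetricSpace X] [TopologicalSpace.SeparableSpace X] [Nonempty X]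
    (hbdd : ∃ C : ℝ, ∀ x y : X, dist x y ≤ C) (A : Set X) (hA : A ≠ Set.univ) :
    ∀ ε > (0 : ℝ), ∀ F : HCube → MSpace X,
      @Continuous HCube (MSpace X) _ (metricTop (mDist (X := X))) F →
      ∃ G : HCube → MSpace X,
        @Continuous HCube (MSpace X) _ (metricTop (mDist (X := X))) G ∧
        Set.range G ∩ mSet A = ∅ ∧
        ∀ q : HCube, mDist (F q) (G q) < ε := by
  obtain ⟨x, hx⟩ := (ne_univ_iff_exists_notMem A).1 hA
  obtain ⟨C₀, hC₀⟩ := hbdd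
  obtain ⟨C, hCpos, hC⟩ : ∃ C > 0, ∀ x y : X, dist x y ≤ C :=
    ⟨max C₀ 1, by positivity, fun x y => (hC₀ x y).trans (le_max_left _ _)⟩
  intro ε hε F hF
  set δ : ℝ := min 1 (ε / (2 * C))
  have hδ : 0 < δ := by positivity
  have hδε : δ * C < ε := by
    calc δ * C ≤ ε / (2 * C) * C := by gcongr; exact min_le_right _ _
      _ = ε / 2 := by field_simp
      _ < ε := half_lt_self hε
  let S : Set I01 := Iic ⟨δ, hδ.le, min_le_left _ _⟩
  have hS : MeasurableSet S := measurableSet_Iic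
  have hvol : volume S = ENNReal.ofReal δ := unitInterval.volume_Iic _
  refine ⟨fun q => patch hS x (F q), ?_, ?_, fun q => ?_⟩
  · exact @Continuous.comp _ _ _ _ (metricTop mDist) (metricTop mDist) _ _
      (continuous_metricTop_of_nonexpansive hC (mDist_patch_patch_le hC hS x)) hF
  · refine eq_empty_of_forall_notMem ?_
    rintro _ ⟨⟨q, rfl⟩, hq⟩
    exact patch_notMem_mSet hS (by simpa [hvol] using hδ) hx (F q) hq
  · refine (mDist_patch_le hC hS x (F q)).trans_lt ?_
    rwa [measureReal_def, hvol, ENNReal.toReal_ofReal hδ.le]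
end

section
/- Let X be a separable metrizable space with at least two points and with a bounded compatible metric d, and let (M(X), D) be the metric space of equivalence classes (modulo Lebesgue-a.e. equality) of Lebesgue measurable functions [0,1] → X with D(f,g) = ∫₀¹ d(f(t), g(t)) dt. For x ∈ X let δ_x ∈ M(X) be the class of the constant function with value x. Then the map δ : X → M(X), x ↦ δ_x, is a closed isometric embedding of (X,d) into (M(X),D), and its image { δ_x : x ∈ X } is a Z-set in (M(X), D). -/
open MeasureTheory Topology Set TopologicalSpace

/-- `δ_x ∈ M(X)`: the class of the constant function with value `x`. -/
noncomputable def mDelta {X : Type*} [TopologicalSpace X] (x : X) : MSpace X :=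
  MeasureTheory.AEEqFun.const I01 x

/-- The distance between measurable representatives is integrable when the metric is bounded. -/
lemma integrable_dist_of_bdd {X : Type*} [MetricSpace X] {C : ℝ}
    (hC : ∀ x y : X, dist x y ≤ C) {f g : I01 → X}
    (hf : AEStronglyMeasurable f volume) (hg : AEStronglyMeasurable g volume) :
    Integrable (fun t => dist (f t) (g t)) (volume : Measure I01) :=
  Integrable.of_bound (hf.dist hg) C (ae_of_all _ fun t => by
    rw [Real.norm_eq_abs, abs_of_nonneg dist_nonneg]
    exact hC _ _)

lemma mDist_congr {X : Type*} [MetricSpace X] {f g : MSpace X} {u v : I01 → X}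
    (hf : f =ᵐ[volume] u) (hg : g =ᵐ[volume] v) :
    mDist f g = ∫ t : I01, dist (u t) (v t) := by
  refine integral_congr_ae ?_
  filter_upwards [hf, hg] with t h₁ h₂
  rw [h₁, h₂]

lemma mDelta_ae_eq {X : Type*} [TopologicalSpace X] (x : X) :
    (mDelta x : MSpace X) =ᵐ[volume] fun _ => x :=
  AEEqFun.coeFn_const I01 x

lemma mDist_mDelta {X : Type*} [MetricSpace X] (x y : X) :
    mDist (mDelta x) (mDelta y) = dist x y := by
  rw [mDist_congr (mDelta_ae_eq x) (mDelta_ae_eq y)]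
  simp

lemma mDist_mDelta_left {X : Type*} [MetricSpace X] (x : X) (f : MSpace X) :
    mDist (mDelta x) f = ∫ t : I01, dist x (f t) :=
  mDist_congr (mDelta_ae_eq x) Filter.EventuallyEq.rfl

lemma mDist_eq_zero {X : Type*} [MetricSpace X] {C : ℝ} (hC : ∀ x y : X, dist x y ≤ C)
    {f g : MSpace X} (h : mDist f g = 0) : f = g := by
  have hi := integrable_dist_of_bdd hC f.aestronglyMeasurable g.aestronglyMeasurable
  have h0 := (integral_eq_zero_iff_of_nonneg (fun t => dist_nonneg) hi).1 h
  refine AEEqFun.ext ?_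
  filter_upwards [h0] with t ht
  exact dist_eq_zero.1 ht

/-- For a bounded metric on `X`, the distance `mDist` makes `MSpace X` a metric space. -/
noncomputable abbrev mMetricSpace (X : Type*) [MetricSpace X] {C : ℝ}
    (hC : ∀ x y : X, dist x y ≤ C) : MetricSpace (MSpace X) where
  dist := mDist
  dist_self f := by simp [mDist]
  dist_comm f g := by simp [mDist, dist_comm]
  dist_triangle f g h := by
    have hi (u v : MSpace X) :=
      integrable_dist_of_bdd hC u.aestronglyMeasurable v.aestronglyMeasurable
    unfold mDist
    rw [← integral_add (hi f g) (hi g h)]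
    exact integral_mono (hi f h) ((hi f g).add (hi g h)) fun t => dist_triangle _ _ _
  eq_of_dist_eq_zero h := mDist_eq_zero hC h

lemma metricTop_dist (S : Type*) [PseudoMetricSpace S] :
    metricTop (dist : S → S → ℝ) = UniformSpace.toTopologicalSpace := by
  refine le_antisymm (fun U hU => ?_) (le_generateFrom ?_)
  · let : TopologicalSpace S := metricTop (dist : S → S → ℝ)
    refine isOpen_iff_mem_nhds.2 fun x hx => ?_
    obtain ⟨ε, hε, hb⟩ := Metric.isOpen_iff.1 hU x hx
    refine mem_nhds_iff.2 ⟨{y | dist x y < ε}, fun y hy => hb ?_,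
      isOpen_generateFrom_of_mem ⟨x, ε, hε, rfl⟩, by simpa using hε⟩
    rw [Metric.mem_ball, dist_comm]
    exact hy
  · rintro U ⟨c, ε, -, rfl⟩
    exact isOpen_lt (by fun_prop) (by fun_prop)

lemma isClosed_range_mDelta {X : Type*} [MetricSpace X] {C : ℝ}
    (hC : ∀ x y : X, dist x y ≤ C) :
    letI := mMetricSpace X hC
    IsClosed (range (mDelta (X := X))) := by
  let := mMetricSpace X hC
  refine isClosed_of_closure_subset fun f hf => ?_
  have hcont : Continuous fun x : X => mDist (mDelta x) f := by
    have hiso : Isometry (mDelta (X := X)) := Isometry.of_dist_eq mDist_mDelta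
    exact hiso.continuous.dist continuous_const
  have hnonneg (x : X) : 0 ≤ mDist (mDelta x) f := dist_nonneg (x := mDelta x) (y := f)
  have hbound (x : X) : mDist (mDelta x) f ≤ C := by
    rw [mDist_mDelta_left]
    refine (integral_mono (integrable_dist_of_bdd hC aestronglyMeasurable_const
      f.aestronglyMeasurable) (integrable_const C) fun t => hC _ _).trans ?_
    simp
  have hint : Integrable (fun s : I01 => mDist (mDelta (f s)) f) volume :=
    Integrable.of_bound (hcont.comp_aestronglyMeasurable f.aestronglyMeasurable) C
      (ae_of_all _ fun s => by
        rw [Real.norm_eq_abs, abs_of_nonneg (hnonneg _)]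
        exact hbound _)
  have hle (x : X) : ∫ s : I01, mDist (mDelta (f s)) f ≤ 2 * mDist (mDelta x) f := by
    have hi : Integrable (fun s : I01 => dist x (f s)) volume :=
      integrable_dist_of_bdd hC aestronglyMeasurable_const f.aestronglyMeasurable
    calc ∫ s : I01, mDist (mDelta (f s)) f
        ≤ ∫ s : I01, (dist x (f s) + mDist (mDelta x) f) := by
          refine integral_mono hint (hi.add (integrable_const _)) fun s => ?_
          have := dist_triangle (mDelta (f s)) (mDelta x) f
          change mDist _ _ ≤ mDist _ _ + mDist _ _ at this
          rwa [mDist_mDelta, dist_comm] at this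
      _ = 2 * mDist (mDelta x) f := by
          rw [integral_add hi (integrable_const _), ← mDist_mDelta_left]
          simp
          ring
  have hzero : ∫ s : I01, mDist (mDelta (f s)) f = 0 := by
    refine le_antisymm (le_of_forall_pos_le_add fun ε hε => ?_)
      (integral_nonneg fun s => hnonneg _)
    obtain ⟨_, ⟨x, rfl⟩, hx⟩ := Metric.mem_closure_iff.1 hf (ε / 2) (half_pos hε)
    rw [dist_comm] at hx
    change mDist _ _ < _ at hx
    linarith [hle x]
  obtain ⟨s, hs⟩ := ((integral_eq_zero_iff_of_nonneg (fun s => hnonneg _) hint).1 hzero).exists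
  exact ⟨f s, mDist_eq_zero hC hs⟩

/-- Overwrite `f` with the value `x` on `[0,a)` and with the value `y` on `[a,b)`. -/
noncomputable def mOverwrite {X : Type*} [TopologicalSpace X] (a b : I01) (x y : X)
    (f : MSpace X) : MSpace X :=
  AEEqFun.mk (fun t => if t < a then x else if t < b then y else f t)
    (StronglyMeasurable.ite measurableSet_Iio stronglyMeasurable_const
      (StronglyMeasurable.ite measurableSet_Iio stronglyMeasurable_const
        f.stronglyMeasurable)).aestronglyMeasurable

lemma mOverwrite_ae_eq {X : Type*} [TopologicalSpace X] (a b : I01) (x y : X) (f : MSpace X) :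
    mOverwrite a b x y f =ᵐ[volume] fun t => if t < a then x else if t < b then y else f t :=
  AEEqFun.coeFn_mk _ _

lemma mDist_mOverwrite_le {X : Type*} [MetricSpace X] {C : ℝ} (hC : ∀ x y : X, dist x y ≤ C)
    (a b : I01) (x y : X) (f g : MSpace X) :
    mDist (mOverwrite a b x y f) (mOverwrite a b x y g) ≤ mDist f g := by
  refine integral_mono_ae (integrable_dist_of_bdd hC (AEEqFun.aestronglyMeasurable _)
    (AEEqFun.aestronglyMeasurable _)) (integrable_dist_of_bdd hC f.aestronglyMeasurable
    g.aestronglyMeasurable) ?_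
  filter_upwards [mOverwrite_ae_eq a b x y f, mOverwrite_ae_eq a b x y g] with t hf hg
  rw [hf, hg]
  split_ifs <;> simp

lemma mDist_self_mOverwrite_le {X : Type*} [MetricSpace X] {C : ℝ}
    (hC : ∀ x y : X, dist x y ≤ C) {a b : I01} (hab : a ≤ b) (x y : X) (f : MSpace X) :
    mDist f (mOverwrite a b x y f) ≤ b * C := by
  have h : mDist f (mOverwrite a b x y f) ≤ ∫ t : I01, (Iio b).indicator (fun _ => C) t := by
    refine integral_mono_ae (integrable_dist_of_bdd hC (AEEqFun.aestronglyMeasurable _)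
      (AEEqFun.aestronglyMeasurable _))
      ((integrable_const C).indicator measurableSet_Iio) ?_
    filter_upwards [mOverwrite_ae_eq a b x y f] with t hf
    rw [hf]
    by_cases hb : t < b
    · rw [indicator_of_mem (mem_Iio.2 hb)]
      exact hC _ _
    · rw [indicator_of_notMem (by simpa using hb), if_neg fun ha => hb (ha.trans_le hab),
        if_neg hb, dist_self]
  refine h.trans_eq ?_
  rw [integral_indicator_const _ measurableSet_Iio, Measure.real, unitInterval.volume_Iio,
    ENNReal.toReal_ofReal b.2.1, smul_eq_mul]

lemma mOverwrite_ne_mDelta {X : Type*} [MetricSpace X] {a b : I01} (ha : 0 < a) (hab : a < b)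
    {x y : X} (hxy : x ≠ y) (f : MSpace X) (z : X) : mOverwrite a b x y f ≠ mDelta z := by
  intro h
  have hz : ∀ᵐ t : I01, (if t < a then x else if t < b then y else f t) = z := by
    filter_upwards [mOverwrite_ae_eq a b x y f, mDelta_ae_eq z] with t h₁ h₂
    rw [← h₁, h, h₂]
  have hx : x = z := by
    have hpos : volume (Iio a) ≠ 0 := by
      rw [unitInterval.volume_Iio]
      simpa using ha
    obtain ⟨t, ht, hta⟩ := ((frequently_ae_mem_iff.2 hpos).and_eventually hz).exists
    rwa [if_pos (mem_Iio.1 ht)] at hta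
  have hy : y = z := by
    have hpos : volume (Ico a b) ≠ 0 := by
      rw [unitInterval.volume_Ico]
      simpa using hab
    obtain ⟨t, ht, hta⟩ := ((frequently_ae_mem_iff.2 hpos).and_eventually hz).exists
    rwa [if_neg ht.1.not_gt, if_pos ht.2] at hta
  exact hxy (hx.trans hy.symm)

/-- **The set of constant functions is a `Z`-set in `(M(X), D)`.**
For a separable metric space `X` with at least two points and bounded metric, the map
`x ↦ δ_x` is a closed isometric embedding of `(X,d)` into `(M(X),D)`, and its image
`{δ_x : x ∈ X}` is a `Z`-set in `(M(X), D)`. -/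
theorem mDelta_closed_isometric_embedding_and_zset
    (X : Type*) [MetricSpace X] [TopologicalSpace.SeparableSpace X]
    (htwo : ∃ x y : X, x ≠ y)
    (hbdd : ∃ C : ℝ, ∀ x y : X, dist x y ≤ C) :
    (∀ x y : X, mDist (mDelta x) (mDelta y) = dist x y) ∧
    @IsEmbedding X (MSpace X) _ (metricTop (mDist (X := X))) mDelta ∧
    @IsClosed (MSpace X) (metricTop (mDist (X := X))) (Set.range (mDelta (X := X))) ∧
    (∀ ε > (0 : ℝ), ∀ F : HCube → MSpace X,
      @Continuous HCube (MSpace X) _ (metricTop (mDist (X := X))) F →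
      ∃ G : HCube → MSpace X,
        @Continuous HCube (MSpace X) _ (metricTop (mDist (X := X))) G ∧
        Set.range G ∩ Set.range (mDelta (X := X)) = ∅ ∧
        ∀ q : HCube, mDist (F q) (G q) < ε) := by
  obtain ⟨x, y, hxy⟩ := htwo
  obtain ⟨C, hC⟩ := hbdd
  let := mMetricSpace X hC
  have htop : metricTop (mDist (X := X)) = UniformSpace.toTopologicalSpace :=
    metricTop_dist (MSpace X)
  rw [htop]
  have hiso : Isometry (mDelta (X := X)) := Isometry.of_dist_eq mDist_mDelta
  refine ⟨mDist_mDelta, hiso.isEmbedding, isClosed_range_mDelta hC, fun ε hε F hF => ?_⟩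
  have hCpos : 0 < C := (dist_pos.2 hxy).trans_le (hC x y)
  obtain ⟨r, hr0, hr⟩ := exists_between (lt_min one_pos (div_pos hε hCpos))
  have hr1 : r < 1 := hr.trans_le (min_le_left _ _)
  have hrC : r * C < ε := (lt_div_iff₀ hCpos).1 (hr.trans_le (min_le_right _ _))
  let b : I01 := ⟨r, hr0.le, hr1.le⟩
  let a : I01 := ⟨r / 2, by linarith, by linarith⟩
  have ha : 0 < a := Subtype.mk_lt_mk.2 (half_pos hr0)
  have hab : a < b := Subtype.mk_lt_mk.2 (half_lt_self hr0)
  refine ⟨fun q => mOverwrite a b x y (F q), ?_, ?_, fun q =>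
    (mDist_self_mOverwrite_le hC hab.le x y (F q)).trans_lt hrC⟩
  · have hlip : LipschitzWith 1 (mOverwrite a b x y) :=
      LipschitzWith.mk_one (mDist_mOverwrite_le hC a b x y)
    exact hlip.continuous.comp hF
  · rw [← disjoint_iff_inter_eq_empty, disjoint_left]
    rintro _ ⟨q, rfl⟩ ⟨z, hz⟩
    exact mOverwrite_ne_mDelta ha hab hxy (F q) z hz.symm
end
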